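/- Every cone admits a unitary embedding into a normally divisible refinement cone; that is, for every cone M there exist a normally divisible refinement cone N and a unitary monoid homomorphism from M into N. -/

import Mathlib

universe u

/-- Conical commutative monoid ("cone"): `x + y = 0` implies `x = y = 0`. -/
def IsConical (M : Type u) [AddCommMonoid M] : Prop :=
  ∀ x y : M, x + y = 0 → x = 0 ∧ y = 0

/-- Algebraic preorder: `x ≤ y` iff `∃ z, x + z = y`. -/
def AlgLE {M : Type u} [AddCommMonoid M] (x y : M) : Prop :=
  ∃ z : M, x + z = y

/-- Refinement monoid. -/
def IsRefinementMonoid (M : Type u) [AddCommMonoid M] : Prop :=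
  ∀ a₀ a₁ b₀ b₁ : M, a₀ + a₁ = b₀ + b₁ →
    ∃ c₀₀ c₀₁ c₁₀ c₁₁ : M,
      a₀ = c₀₀ + c₀₁ ∧ a₁ = c₁₀ + c₁₁ ∧ b₀ = c₀₀ + c₁₀ ∧ b₁ = c₀₁ + c₁₁

/-- Unitary homomorphism: injective, cofinal image, and `f a₀ + b = f a₁ → b ∈ range f`. -/
def IsUnitary {A : Type u} {B : Type u} [AddCommMonoid A] [AddCommMonoid B]
    (f : A →+ B) : Prop :=
  Function.Injective f ∧
  (∀ b : B, ∃ a : A, AlgLE b (f a)) ∧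
  (∀ a₀ a₁ : A, ∀ b : B, f a₀ + b = f a₁ → b ∈ Set.range f)

/-- Strongly unitary homomorphism. -/
def IsStronglyUnitary {A : Type u} {B : Type u} [AddCommMonoid A] [AddCommMonoid B]
    (f : A →+ B) : Prop :=
  IsUnitary f ∧ ∀ m : ℕ, 0 < m → ∀ b : B, m • b ∈ Set.range f → b ∈ Set.range f

/-- Normally divisible commutative monoid. -/
def IsNormallyDivisible (M : Type u) [AddCommMonoid M] : Prop :=
  ∀ p : ℕ, 0 < p → ∀ X : Finset M, ∀ a : M,
    ∃ u : M, p • u = a ∧ ∀ x ∈ X, ∀ y ∈ X, x + a = y + a → x + u = y + u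

/-- Order-embedding of commutative monoids (w.r.t. the algebraic preorders). -/
def IsOrderEmbeddingHom {A : Type u} {B : Type u} [AddCommMonoid A] [AddCommMonoid B]
    (f : A →+ B) : Prop :=
  Function.Injective f ∧ ∀ x y : A, AlgLE x y ↔ AlgLE (f x) (f y)

/-- Simple commutative monoid: every `u ≰ 0` is an order-unit. -/
def IsSimpleMonoid (M : Type u) [AddCommMonoid M] : Prop :=
  ∀ u : M, ¬ AlgLE u 0 → ∀ x : M, ∃ n : ℕ, 0 < n ∧ AlgLE x (n • u)

/-- Weak sum decomposition axiom (WSD). -/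
def WSD (M : Type u) [AddCommMonoid M] : Prop :=
  ∀ a₀ a₁ b c : M, a₀ + a₁ + c = b + c →
    ∃ x₀ x₁ : M, a₀ + c = x₀ + c ∧ a₁ + c = x₁ + c ∧ b = x₀ + x₁

/-- `a ∝ b` : `a ≤ n • b` for some positive integer `n`. -/
def Propto {M : Type u} [AddCommMonoid M] (a b : M) : Prop :=
  ∃ n : ℕ, 0 < n ∧ AlgLE a (n • b)

/-- `a ≍ b` : `a ∝ b` and `b ∝ a`. -/
def Asymp {M : Type u} [AddCommMonoid M] (a b : M) : Prop :=
  Propto a b ∧ Propto b a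

/-- Cancellative commutative monoid. -/
def IsCancellativeMonoid (M : Type u) [AddCommMonoid M] : Prop :=
  ∀ x y z : M, x + z = y + z → x = y

/-- Separative commutative monoid. -/
def IsSeparative (M : Type u) [AddCommMonoid M] : Prop :=
  ∀ x y : M, 2 • x = x + y → x + y = 2 • y → x = y

/-- Stably finite commutative monoid. -/
def IsStablyFinite (M : Type u) [AddCommMonoid M] : Prop :=
  ∀ x y : M, x + y = y → x = 0

/-- Quasi-divisible commutative monoid. -/
def IsQuasiDivisible (M : Type u) [AddCommMonoid M] : Prop :=
  ∀ x : M, ∃ u v : M, 2 • u + 3 • v = x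

/-- `ℙ`-torsion-free commutative monoid. -/
def PTorsionFree (P : Set ℕ) (M : Type u) [AddCommMonoid M] : Prop :=
  ∀ p ∈ P, ∀ x y : M, p • x = p • y → x = y

/-- `ℙ`-unperforated commutative monoid (w.r.t. the algebraic preorder). -/
def PUnperforated (P : Set ℕ) (M : Type u) [AddCommMonoid M] : Prop :=
  ∀ p ∈ P, ∀ x y : M, AlgLE (p • x) (p • y) → AlgLE x y

theorem IsConical.smul_eq_zero {M : Type u} [AddCommMonoid M] (hM : IsConical M) {n : ℕ} {a : M}
    (ha : a ≠ 0) (h : n • a = 0) : n = 0 := by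
  cases n with
  | zero => rfl
  | succ k =>
    rw [succ_nsmul] at h
    exact absurd (hM _ _ h).2 ha

theorem IsConical.sum_eq_zero {M : Type u} [AddCommMonoid M] (hM : IsConical M) {ι : Type*}
    (s : Finset ι) (g : ι → M) (h : ∑ i ∈ s, g i = 0) : ∀ i ∈ s, g i = 0 := by
  classical
  induction s using Finset.induction_on with
  | empty => simp
  | insert j s hj ih =>
    rw [Finset.sum_insert hj] at h
    obtain ⟨h₁, h₂⟩ := hM _ _ h
    intro i hi
    rcases Finset.mem_insert.mp hi with rfl | hi
    · exact h₁
    · exact ih h₂ i hi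

theorem IsUnitary.id {A : Type u} [AddCommMonoid A] : IsUnitary (AddMonoidHom.id A) :=
  ⟨Function.injective_id, fun b ↦ ⟨b, 0, add_zero b⟩, fun _ _ b _ ↦ ⟨b, rfl⟩⟩

theorem IsUnitary.comp {A B C : Type u} [AddCommMonoid A] [AddCommMonoid B] [AddCommMonoid C]
    {g : B →+ C} {f : A →+ B} (hg : IsUnitary g) (hf : IsUnitary f) : IsUnitary (g.comp f) := by
  refine ⟨hg.1.comp hf.1, fun c ↦ ?_, fun a₀ a₁ c h ↦ ?_⟩
  · obtain ⟨b, z, hz⟩ := hg.2.1 c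
    obtain ⟨a, w, hw⟩ := hf.2.1 b
    exact ⟨a, z + g w, by rw [← add_assoc, hz, ← map_add, hw]; rfl⟩
  · obtain ⟨b, rfl⟩ := hg.2.2 (f a₀) (f a₁) c h
    obtain ⟨a, rfl⟩ := hf.2.2 a₀ a₁ b (hg.1 ((map_add g _ _).trans h))
    exact ⟨a, rfl⟩

/-- A partial homomorphism `φ` from `F` to `M`, defined on a unitary submonoid `S` of `F`,
with zero kernel. -/
structure PartialHom (M : Type u) (F : Type*) [AddCommMonoid M] [AddCommMonoid F] where
  /-- The domain of the partial homomorphism. -/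
  S : AddSubmonoid F
  /-- The underlying function; its values outside of `S` are irrelevant. -/
  φ : F → M
  φ_zero : φ 0 = 0
  φ_add : ∀ s ∈ S, ∀ t ∈ S, φ (s + t) = φ s + φ t
  mem_of_add_mem : ∀ s ∈ S, ∀ f, s + f ∈ S → f ∈ S
  exists_add_mem : ∀ f, ∃ g, f + g ∈ S
  eq_zero : ∀ s ∈ S, φ s = 0 → s = 0

namespace PartialHom

section Extension

variable {M : Type u} {F : Type u} [AddCommMonoid M] [AddCommMonoid F] (d : PartialHom M F)

theorem add_mem_iff {s : F} (hs : s ∈ d.S) (f : F) : s + f ∈ d.S ↔ f ∈ d.S :=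
  ⟨d.mem_of_add_mem s hs f, d.S.add_mem hs⟩

/-- A congruence on `M × F` that separates the points of `M` and identifies every `s`
in the domain of `d` with its image in `M`. -/
def con : AddCon (M × F) where
  r x y := ∀ h, (x.2 + h ∈ d.S ↔ y.2 + h ∈ d.S) ∧
    (x.2 + h ∈ d.S → x.1 + d.φ (x.2 + h) = y.1 + d.φ (y.2 + h))
  iseqv :=
    { refl := fun _ _ ↦ ⟨Iff.rfl, fun _ ↦ rfl⟩
      symm := fun H h ↦ ⟨(H h).1.symm, fun hh ↦ ((H h).2 ((H h).1.mpr hh)).symm⟩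
      trans := fun H K h ↦ ⟨(H h).1.trans (K h).1,
        fun hh ↦ ((H h).2 hh).trans ((K h).2 ((H h).1.mp hh))⟩ }
  add' := by
    intro w x y z H K h
    have H' := H (y.2 + h)
    have K' := K (x.2 + h)
    have e₁ : (w + y).2 + h = w.2 + (y.2 + h) := by rw [Prod.snd_add, add_assoc]
    have e₂ : x.2 + (y.2 + h) = y.2 + (x.2 + h) := add_left_comm _ _ _
    have e₃ : (x + z).2 + h = z.2 + (x.2 + h) := by
      rw [Prod.snd_add, add_comm x.2, add_assoc]
    rw [e₂] at H'
    rw [e₁, e₃]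
    refine ⟨H'.1.trans K'.1, fun hh ↦ ?_⟩
    rw [Prod.fst_add, Prod.fst_add, add_comm w.1, add_assoc, H'.2 hh, add_left_comm,
      K'.2 (H'.1.mp hh), add_assoc]

/-- The extension of `M` obtained by adjoining `F` along the partial homomorphism `d`. -/
def Ext : Type u := d.con.Quotient

instance : AddCommMonoid d.Ext := inferInstanceAs (AddCommMonoid d.con.Quotient)

/-- The canonical map from `M × F` onto the extension. -/
def toExt : M × F →+ d.Ext := d.con.mk'

theorem toExt_eq_toExt {x y : M × F} : d.toExt x = d.toExt y ↔
    ∀ h, (x.2 + h ∈ d.S ↔ y.2 + h ∈ d.S) ∧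
      (x.2 + h ∈ d.S → x.1 + d.φ (x.2 + h) = y.1 + d.φ (y.2 + h)) :=
  d.con.eq

theorem toExt_surjective : Function.Surjective d.toExt := AddCon.mk'_surjective

/-- The canonical map from `M` to the extension. -/
def incl : M →+ d.Ext := d.toExt.comp (AddMonoidHom.inl M F)

theorem incl_apply (m : M) : d.incl m = d.toExt (m, 0) := rfl

theorem toExt_of_mem (m : M) {s : F} (hs : s ∈ d.S) : d.toExt (m, s) = d.incl (m + d.φ s) := by
  refine d.toExt_eq_toExt.mpr fun h ↦ ?_
  simp only [AddMonoidHom.inl_apply, zero_add]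
  refine ⟨d.add_mem_iff hs h, fun hh ↦ ?_⟩
  rw [d.φ_add s hs h ((d.add_mem_iff hs h).mp hh), add_assoc]

theorem mem_of_toExt_eq_incl {m m' : M} {f : F} (h : d.toExt (m, f) = d.incl m') :
    f ∈ d.S ∧ m + d.φ f = m' := by
  have := d.toExt_eq_toExt.mp h 0
  simp only [AddMonoidHom.inl_apply, add_zero, d.φ_zero, d.S.zero_mem, iff_true] at this
  exact ⟨this.1, this.2 this.1⟩

theorem isUnitary_incl : IsUnitary d.incl := by
  refine ⟨fun m m' h ↦ ?_, fun b ↦ ?_, fun a₀ a₁ b h ↦ ?_⟩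
  · simpa [d.φ_zero] using (d.mem_of_toExt_eq_incl (f := 0) h).2
  · obtain ⟨⟨m, f⟩, rfl⟩ := d.toExt_surjective b
    obtain ⟨g, hg⟩ := d.exists_add_mem f
    refine ⟨m + d.φ (f + g), d.toExt (0, g), ?_⟩
    rw [← map_add, Prod.mk_add_mk, add_zero, d.toExt_of_mem m hg]
  · obtain ⟨⟨m, f⟩, rfl⟩ := d.toExt_surjective b
    rw [incl_apply, ← map_add, Prod.mk_add_mk, zero_add] at h
    exact ⟨_, (d.toExt_of_mem m (d.mem_of_toExt_eq_incl h).1).symm⟩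

theorem isConical_ext (hM : IsConical M) (hF : IsConical F) : IsConical d.Ext := by
  intro x y h
  obtain ⟨⟨m, f⟩, rfl⟩ := d.toExt_surjective x
  obtain ⟨⟨n, g⟩, rfl⟩ := d.toExt_surjective y
  rw [← map_add, Prod.mk_add_mk, ← map_zero d.incl] at h
  obtain ⟨hS, h⟩ := d.mem_of_toExt_eq_incl h
  obtain ⟨hmn, hφ⟩ := hM _ _ h
  obtain ⟨rfl, rfl⟩ := hM _ _ hmn
  obtain ⟨rfl, rfl⟩ := hF _ _ (d.eq_zero _ hS hφ)
  exact ⟨map_zero d.toExt, map_zero d.toExt⟩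

end Extension

section Finsupp

variable {M : Type u} {G : Type*} {ι : Type*} [AddCommMonoid M] [AddCommMonoid G]

/-- The direct sum of a family of partial homomorphisms. -/
noncomputable def finsupp (hM : IsConical M) (d : ι → PartialHom M G) :
    PartialHom M (ι →₀ G) where
  S :=
    { carrier := {f | ∀ i, f i ∈ (d i).S}
      zero_mem' := fun i ↦ (d i).S.zero_mem
      add_mem' := fun hf hg i ↦ (d i).S.add_mem (hf i) (hg i) }
  φ f := f.sum fun i ↦ (d i).φ
  φ_zero := Finsupp.sum_zero_index
  φ_add s hs t ht := by
    classical
    have hφ : ∀ i ∈ s.support ∪ t.support, (d i).φ 0 = 0 := fun i _ ↦ (d i).φ_zero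
    rw [Finsupp.sum_of_support_subset _ Finsupp.support_add _ hφ,
      Finsupp.sum_of_support_subset s Finset.subset_union_left _ hφ,
      Finsupp.sum_of_support_subset t Finset.subset_union_right _ hφ, ← Finset.sum_add_distrib]
    exact Finset.sum_congr rfl fun i _ ↦ (d i).φ_add _ (hs i) _ (ht i)
  mem_of_add_mem s hs f hf i := (d i).mem_of_add_mem _ (hs i) _ (hf i)
  exists_add_mem f := by
    classical
    choose g hg using fun i ↦ (d i).exists_add_mem (f i)
    refine ⟨Finsupp.onFinset f.support (fun i ↦ if f i = 0 then 0 else g i)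
      fun i hi ↦ by aesop, fun i ↦ ?_⟩
    by_cases hi : f i = 0
    · simp [hi]
    · simpa [hi] using hg i
  eq_zero s hs h := by
    ext i
    by_contra hi
    exact hi ((d i).eq_zero _ (hs i)
      (hM.sum_eq_zero _ _ h i (Finsupp.mem_support_iff.mpr hi)))

variable (hM : IsConical M) (d : ι → PartialHom M G)

theorem finsupp_φ_apply (f : ι →₀ G) :
    (finsupp hM d).φ f = f.sum fun i ↦ (d i).φ := rfl

theorem single_mem_finsupp {i : ι} {x : G} (hx : x ∈ (d i).S) :
    Finsupp.single i x ∈ (finsupp hM d).S := by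
  classical
  intro j
  rw [Finsupp.single_apply]
  split_ifs with h
  · exact h ▸ hx
  · exact (d j).S.zero_mem

theorem finsupp_φ_single (i : ι) (x : G) :
    (finsupp hM d).φ (Finsupp.single i x) = (d i).φ x :=
  Finsupp.sum_single_index (d i).φ_zero

theorem finsupp_φ_single_add (i : ι) (x : G) (h : ι →₀ G) :
    (finsupp hM d).φ (Finsupp.single i x + h) =
      (d i).φ (x + h i) + (finsupp hM d).φ (h.erase i) := by
  rw [finsupp_φ_apply, ← Finsupp.add_sum_erase' _ i _ fun j ↦ (d j).φ_zero]
  simp [finsupp_φ_apply, Finsupp.erase_add]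

end Finsupp

section Problems

variable {M : Type u} [AddCommMonoid M]

theorem refinement_aux {a₀ a₁ b₀ b₁ : M} (h : a₀ + a₁ = b₀ + b₁) (p q r s : ℕ) :
    min (p + r) (p + s) • a₀ + min (q + r) (q + s) • a₁ + ((p + r) - (p + s)) • b₀ +
      ((p + s) - (p + r)) • b₁ = p • a₀ + q • a₁ + r • b₀ + s • b₁ := by
  have key (n : ℕ) : n • a₀ + n • a₁ = n • b₀ + n • b₁ := by rw [← nsmul_add, h, nsmul_add]
  rcases le_total r s with hrs | hrs <;> obtain ⟨e, rfl⟩ := Nat.exists_eq_add_of_le hrs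
  · rw [min_eq_left (by omega), min_eq_left (by omega), show p + r - (p + (r + e)) = 0 by omega,
      show p + (r + e) - (p + r) = e by omega]
    calc _ = p • a₀ + q • a₁ + (r • a₀ + r • a₁) + e • b₁ := by simp only [add_smul, zero_smul]; abel
      _ = _ := by rw [key]; simp only [add_smul]; abel
  · rw [min_eq_right (by omega), min_eq_right (by omega), show p + s - (p + (s + e)) = 0 by omega,
      show p + (s + e) - (p + s) = e by omega]
    calc _ = p • a₀ + q • a₁ + (s • a₀ + s • a₁) + e • b₀ := by simp only [add_smul, zero_smul]; abel
      _ = _ := by rw [key]; simp only [add_smul]; abel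

/-- The partial homomorphism on `ℕ × ℕ × ℕ × ℕ`, thought of as `2 × 2` matrices, that maps the row
sums to `a₀`, `a₁` and the column sums to `b₀`, `b₁`. -/
def refinement (hM : IsConical M) {a₀ a₁ b₀ b₁ : M} (h : a₀ + a₁ = b₀ + b₁)
    (ha₀ : a₀ ≠ 0) (ha₁ : a₁ ≠ 0) (hb₀ : b₀ ≠ 0) (hb₁ : b₁ ≠ 0) :
    PartialHom M (ℕ × ℕ × ℕ × ℕ) where
  S :=
    { carrier := {c | ∃ p q r s, c = (p + r, p + s, q + r, q + s)}
      zero_mem' := ⟨0, 0, 0, 0, rfl⟩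
      add_mem' := by
        rintro _ _ ⟨p, q, r, s, rfl⟩ ⟨p', q', r', s', rfl⟩
        refine ⟨p + p', q + q', r + r', s + s', ?_⟩
        simp only [Prod.mk_add_mk, Prod.mk.injEq]
        omega }
  φ c := min c.1 c.2.1 • a₀ + min c.2.2.1 c.2.2.2 • a₁ + (c.1 - c.2.1) • b₀ + (c.2.1 - c.1) • b₁
  φ_zero := by simp
  φ_add := by
    rintro _ ⟨p, q, r, s, rfl⟩ _ ⟨p', q', r', s', rfl⟩
    simp only [Prod.mk_add_mk]
    rw [add_add_add_comm p r, add_add_add_comm p s, add_add_add_comm q r, add_add_add_comm q s,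
      refinement_aux h, refinement_aux h, refinement_aux h]
    simp only [add_smul]
    abel
  mem_of_add_mem := by
    rintro _ ⟨p, q, r, s, rfl⟩ ⟨c₀, c₁, c₂, c₃⟩ ⟨p', q', r', s', hc⟩
    simp only [Prod.mk_add_mk, Prod.mk.injEq] at hc
    refine ⟨min c₀ c₁, min c₂ c₃, c₀ - c₁, c₁ - c₀, ?_⟩
    simp only [Prod.mk.injEq]
    omega
  exists_add_mem := by
    rintro ⟨c₀, c₁, c₂, c₃⟩
    refine ⟨(c₁ + c₂ + c₃, c₀ + c₂ + c₃, c₀ + c₁ + c₃, c₀ + c₁ + c₂),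
      c₀ + c₁ + c₂ + c₃, c₀ + c₁ + c₂ + c₃, 0, 0, ?_⟩
    simp only [Prod.mk_add_mk, Prod.mk.injEq]
    omega
  eq_zero := by
    rintro _ ⟨p, q, r, s, rfl⟩ hc
    simp only at hc
    rw [refinement_aux h] at hc
    obtain ⟨hc, hs⟩ := hM _ _ hc
    obtain ⟨hc, hr⟩ := hM _ _ hc
    obtain ⟨hp, hq⟩ := hM _ _ hc
    rw [hM.smul_eq_zero ha₀ hp, hM.smul_eq_zero ha₁ hq, hM.smul_eq_zero hb₀ hr,
      hM.smul_eq_zero hb₁ hs]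
    rfl

/-- The sum of the four coordinates. -/
def coordSum : ℕ × ℕ × ℕ × ℕ →+ ℕ where
  toFun c := c.1 + c.2.1 + c.2.2.1 + c.2.2.2
  map_zero' := rfl
  map_add' c c' := by simp only [Prod.fst_add, Prod.snd_add]; omega

theorem coordSum_eq_zero {c : ℕ × ℕ × ℕ × ℕ} (h : coordSum c = 0) : c = 0 := by
  obtain ⟨c₀, c₁, c₂, c₃⟩ := c
  change c₀ + c₁ + c₂ + c₃ = 0 at h
  simp only [Prod.mk_eq_zero]
  omega

/-- The partial homomorphism sending `c` to `n • a` whenever the coordinates of `c` sum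
up to `p * n`. -/
def division (hM : IsConical M) {p : ℕ} (hp : 0 < p) {a : M} (ha : a ≠ 0) :
    PartialHom M (ℕ × ℕ × ℕ × ℕ) where
  S :=
    { carrier := {c | p ∣ coordSum c}
      zero_mem' := dvd_zero p
      add_mem' := fun {c c'} hc hc' ↦ by
        rw [Set.mem_ofPred_eq, map_add]
        exact dvd_add hc hc' }
  φ c := (coordSum c / p) • a
  φ_zero := by simp
  φ_add s hs t _ := by
    rw [map_add, Nat.add_div_of_dvd_right hs, add_smul]
  mem_of_add_mem s hs f hf := by
    change p ∣ coordSum (s + f) at hf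
    rw [map_add] at hf
    exact (Nat.dvd_add_right hs).mp hf
  exists_add_mem f := by
    refine ⟨(p - 1) • f, ?_⟩
    rw [← succ_nsmul', show p - 1 + 1 = p by omega]
    change p ∣ coordSum (p • f)
    rw [map_nsmul]
    exact dvd_mul_right _ _
  eq_zero s hs h := by
    apply coordSum_eq_zero
    obtain ⟨k, hk⟩ : p ∣ coordSum s := hs
    rw [hk, Nat.mul_div_cancel_left _ hp] at h
    rw [hk, hM.smul_eq_zero ha h, mul_zero]

end Problems

end PartialHom

/-- The homomorphism `f` provides solutions to all refinement and normal division problems with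
parameters in its domain. -/
def SolvesProblems {A : Type u} {B : Type u} [AddCommMonoid A] [AddCommMonoid B]
    (f : A →+ B) : Prop :=
  (∀ a₀ a₁ b₀ b₁ : A, a₀ + a₁ = b₀ + b₁ → ∃ c₀₀ c₀₁ c₁₀ c₁₁ : B,
    f a₀ = c₀₀ + c₀₁ ∧ f a₁ = c₁₀ + c₁₁ ∧ f b₀ = c₀₀ + c₁₀ ∧ f b₁ = c₀₁ + c₁₁) ∧
  ∀ p : ℕ, 0 < p → ∀ a : A, ∃ u : B, p • u = f a ∧
    ∀ x y : A, x + a = y + a → f x + u = f y + u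

section Step

variable {M : Type u} [AddCommMonoid M] (hM : IsConical M)

/-- The direct sum of all partial homomorphisms from `ℕ × ℕ × ℕ × ℕ` to `M`. -/
noncomputable def universalPartialHom :
    PartialHom M (PartialHom M (ℕ × ℕ × ℕ × ℕ) →₀ ℕ × ℕ × ℕ × ℕ) :=
  PartialHom.finsupp hM fun d ↦ d

theorem isConical_universalPartialHom_ext : IsConical (universalPartialHom hM).Ext := by
  refine (universalPartialHom hM).isConical_ext hM fun f g h ↦ ?_
  have key (d) : f d = 0 ∧ g d = 0 := by
    have : f d + g d = 0 := DFunLike.congr_fun h d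
    generalize f d = x at *
    generalize g d = y at *
    obtain ⟨x₀, x₁, x₂, x₃⟩ := x
    obtain ⟨y₀, y₁, y₂, y₃⟩ := y
    simp only [Prod.mk_add_mk, Prod.mk_eq_zero] at this ⊢
    omega
  exact ⟨Finsupp.ext fun d ↦ (key d).1, Finsupp.ext fun d ↦ (key d).2⟩

/-- The canonical map to the universal extension from the copy of `ℕ × ℕ × ℕ × ℕ` indexed by
the partial homomorphism `d`. -/
noncomputable def universalPartialHom.single (d : PartialHom M (ℕ × ℕ × ℕ × ℕ)) :
    ℕ × ℕ × ℕ × ℕ →+ (universalPartialHom hM).Ext :=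
  ((universalPartialHom hM).toExt.comp (AddMonoidHom.inr M _)).comp (Finsupp.singleAddHom d)

theorem universalPartialHom.single_of_mem (d : PartialHom M (ℕ × ℕ × ℕ × ℕ))
    {x : ℕ × ℕ × ℕ × ℕ} (hx : x ∈ d.S) :
    universalPartialHom.single hM d x = (universalPartialHom hM).incl (d.φ x) := by
  refine ((universalPartialHom hM).toExt_of_mem 0
    (PartialHom.single_mem_finsupp hM _ hx)).trans ?_
  rw [zero_add]
  exact congrArg _ (PartialHom.finsupp_φ_single hM (fun d ↦ d) d x)

theorem exists_refinement_universalPartialHom {a₀ a₁ b₀ b₁ : M} (h : a₀ + a₁ = b₀ + b₁) :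
    ∃ c₀₀ c₀₁ c₁₀ c₁₁ : (universalPartialHom hM).Ext,
      (universalPartialHom hM).incl a₀ = c₀₀ + c₀₁ ∧
      (universalPartialHom hM).incl a₁ = c₁₀ + c₁₁ ∧
      (universalPartialHom hM).incl b₀ = c₀₀ + c₁₀ ∧
      (universalPartialHom hM).incl b₁ = c₀₁ + c₁₁ := by
  set ε := (universalPartialHom hM).incl
  by_cases ha₀ : a₀ = 0
  · subst ha₀
    rw [zero_add] at h
    exact ⟨0, 0, ε b₀, ε b₁, by simp [h]⟩
  by_cases ha₁ : a₁ = 0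
  · subst ha₁
    rw [add_zero] at h
    exact ⟨ε b₀, ε b₁, 0, 0, by simp [h]⟩
  by_cases hb₀ : b₀ = 0
  · subst hb₀
    rw [zero_add] at h
    exact ⟨0, ε a₀, 0, ε a₁, by simp [← h]⟩
  by_cases hb₁ : b₁ = 0
  · subst hb₁
    rw [add_zero] at h
    exact ⟨ε a₀, 0, ε a₁, 0, by simp [← h]⟩
  let d := PartialHom.refinement hM h ha₀ ha₁ hb₀ hb₁
  have key (x y : ℕ × ℕ × ℕ × ℕ) (m : M) (hS : x + y ∈ d.S) (hm : d.φ (x + y) = m) :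
      ε m = universalPartialHom.single hM d x + universalPartialHom.single hM d y := by
    rw [← map_add, universalPartialHom.single_of_mem hM d hS, hm]
  refine ⟨universalPartialHom.single hM d (1, 0, 0, 0),
    universalPartialHom.single hM d (0, 1, 0, 0), universalPartialHom.single hM d (0, 0, 1, 0),
    universalPartialHom.single hM d (0, 0, 0, 1), key _ _ _ ⟨1, 0, 0, 0, rfl⟩ ?_,
    key _ _ _ ⟨0, 1, 0, 0, rfl⟩ ?_, key _ _ _ ⟨0, 0, 1, 0, rfl⟩ ?_,
    key _ _ _ ⟨0, 0, 0, 1, rfl⟩ ?_⟩ <;>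
  simp [d, PartialHom.refinement]

theorem exists_division_universalPartialHom {p : ℕ} (hp : 0 < p) (a : M) :
    ∃ u : (universalPartialHom hM).Ext, p • u = (universalPartialHom hM).incl a ∧
      ∀ x y : M, x + a = y + a →
        (universalPartialHom hM).incl x + u = (universalPartialHom hM).incl y + u := by
  by_cases ha : a = 0
  · subst ha
    refine ⟨0, by simp, fun x y h ↦ ?_⟩
    rw [add_zero, add_zero] at h
    rw [h]
  let d := PartialHom.division hM hp ha
  refine ⟨universalPartialHom.single hM d (1, 0, 0, 0), ?_, fun x y h ↦ ?_⟩
  · have hc : PartialHom.coordSum (p • (1, 0, 0, 0)) = p := by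
      rw [map_nsmul]
      exact mul_one p
    rw [← map_nsmul, universalPartialHom.single_of_mem]
    · change (universalPartialHom hM).incl ((PartialHom.coordSum _ / p) • a) = _
      rw [hc, Nat.div_self hp, one_smul]
    · change p ∣ PartialHom.coordSum _
      rw [hc]
  · have key (z : M) : (universalPartialHom hM).incl z +
        universalPartialHom.single hM d (1, 0, 0, 0) =
          (universalPartialHom hM).toExt (z, Finsupp.single d (1, 0, 0, 0)) := by
      rw [PartialHom.incl_apply]
      refine ((universalPartialHom hM).toExt.map_add _ _).symm.trans ?_
      simp
    rw [key, key]
    refine (universalPartialHom hM).toExt_eq_toExt.mpr fun k ↦ ⟨Iff.rfl, fun hk ↦ ?_⟩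
    have hk' : p ∣ PartialHom.coordSum ((1, 0, 0, 0) + k d) := by
      have := hk d
      rwa [Finsupp.add_apply, Finsupp.single_eq_same] at this
    have e : (universalPartialHom hM).φ (Finsupp.single d (1, 0, 0, 0) + k) =
        (PartialHom.coordSum ((1, 0, 0, 0) + k d) / p) • a +
          (universalPartialHom hM).φ (k.erase d) :=
      PartialHom.finsupp_φ_single_add hM (fun d ↦ d) d (1, 0, 0, 0) k
    obtain ⟨n, hn⟩ := hk'
    have hn₀ : n ≠ 0 := by
      rintro rfl
      rw [map_add, mul_zero] at hn
      have h₁ : PartialHom.coordSum (1, 0, 0, 0) = 1 := rfl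
      omega
    obtain ⟨n, rfl⟩ := Nat.exists_eq_succ_of_ne_zero hn₀
    simp only
    rw [e, hn, Nat.mul_div_cancel_left _ hp, Nat.succ_eq_add_one, succ_nsmul', ← add_assoc,
      ← add_assoc, ← add_assoc, ← add_assoc, h]

theorem solvesProblems_universalPartialHom : SolvesProblems (universalPartialHom hM).incl :=
  ⟨fun _ _ _ _ ↦ exists_refinement_universalPartialHom hM,
    fun _ ↦ exists_division_universalPartialHom hM⟩

end Step

section Limit

variable {T : ℕ → Type u} [∀ n, AddCommMonoid (T n)] (step : ∀ n, T n →+ T (n + 1))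

/-- The composite of the maps `step k` for `i ≤ k < j`. -/
def transition (i j : ℕ) (h : i ≤ j) : T i →+ T j :=
  Nat.leRec (motive := fun j _ ↦ T i →+ T j) (AddMonoidHom.id _) (fun k _ g ↦ (step k).comp g) h

theorem transition_self (i : ℕ) : transition step i i le_rfl = AddMonoidHom.id _ :=
  Nat.leRec_self _ _

theorem transition_succ (i j : ℕ) (h : i ≤ j) :
    transition step i (j + 1) (h.trans j.le_succ) = (step j).comp (transition step i j h) :=
  Nat.leRec_succ _ _ h

instance transition_directedSystem : DirectedSystem T (transition step · · ·) where
  map_self i x := by rw [transition_self]; rfl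
  map_map k j i hij hjk x := by
    induction k, hjk using Nat.le_induction with
    | base => rw [transition_self]; rfl
    | succ l hjl ih =>
      rw [transition_succ step j l hjl, transition_succ step i l (hij.trans hjl)]
      exact congrArg (step l) ih

theorem isUnitary_transition (hs : ∀ n, IsUnitary (step n)) (i j : ℕ) (h : i ≤ j) :
    IsUnitary (transition step i j h) := by
  induction j, h using Nat.le_induction with
  | base => rw [transition_self]; exact IsUnitary.id
  | succ j hij ih => rw [transition_succ step i j hij]; exact (hs j).comp ih

/-- The colimit of the sequence `step`. -/
abbrev SeqLimit : Type u := DirectLimit T (transition step)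

/-- The canonical map to the colimit. -/
def SeqLimit.of (i : ℕ) : T i →+ SeqLimit step where
  toFun x := ⟦⟨i, x⟩⟧
  map_zero' := (DirectLimit.zero_def i).symm
  map_add' x y := (DirectLimit.add_def i x y).symm

namespace SeqLimit

theorem of_transition {i j : ℕ} (h : i ≤ j) (x : T i) :
    of step j (transition step i j h x) = of step i x :=
  DirectLimit.mk_apply i j x h

theorem of_step (i : ℕ) (x : T i) : of step (i + 1) (step i x) = of step i x := by
  rw [← of_transition step i.le_succ x, transition_succ step i i le_rfl, transition_self]
  rfl

theorem exists_of (z : SeqLimit step) : ∃ i x, of step i x = z := by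
  obtain ⟨i, x, rfl⟩ := DirectLimit.exists_eq_mk _ z
  exact ⟨i, x, rfl⟩

theorem exists_of_finset (X : Finset (SeqLimit step)) :
    ∃ i, ∀ z ∈ X, ∃ x, of step i x = z := by
  choose n x hx using exists_of step
  refine ⟨X.sup n, fun z hz ↦ ⟨transition step (n z) _ (Finset.le_sup hz) (x z), ?_⟩⟩
  rw [of_transition, hx]

variable (hs : ∀ n, IsUnitary (step n))
include hs

theorem of_injective (i : ℕ) : Function.Injective (of step i) :=
  DirectLimit.mk_injective _ (fun i j h ↦ (isUnitary_transition step hs i j h).1) i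

theorem isUnitary_of (i : ℕ) : IsUnitary (of step i) := by
  have lift (z : SeqLimit step) : ∃ j, ∃ _ : i ≤ j, ∃ y, of step j y = z := by
    obtain ⟨j, y, rfl⟩ := exists_of step z
    exact ⟨max i j, le_max_left i j, _, of_transition step (le_max_right i j) y⟩
  refine ⟨of_injective step hs i, fun z ↦ ?_, fun a₀ a₁ z h ↦ ?_⟩
  · obtain ⟨j, hij, y, rfl⟩ := lift z
    obtain ⟨a, w, hw⟩ := (isUnitary_transition step hs i j hij).2.1 y
    exact ⟨a, of step j w, by rw [← map_add, hw, of_transition]⟩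
  · obtain ⟨j, hij, y, rfl⟩ := lift z
    rw [← of_transition step hij, ← of_transition step hij, ← map_add] at h
    obtain ⟨a, rfl⟩ := (isUnitary_transition step hs i j hij).2.2 a₀ a₁ y
      (of_injective step hs j h)
    exact ⟨a, (of_transition step hij a).symm⟩

theorem isConical (hT : ∀ n, IsConical (T n)) : IsConical (SeqLimit step) := by
  classical
  intro x y h
  obtain ⟨i, hi⟩ := exists_of_finset step {x, y}
  obtain ⟨x, rfl⟩ := hi x (by simp)
  obtain ⟨y, rfl⟩ := hi y (by simp)
  rw [← map_add, ← map_zero (of step i)] at h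
  obtain ⟨rfl, rfl⟩ := hT i _ _ (of_injective step hs i h)
  exact ⟨map_zero _, map_zero _⟩

theorem isRefinementMonoid (hp : ∀ n, SolvesProblems (step n)) :
    IsRefinementMonoid (SeqLimit step) := by
  classical
  intro a₀ a₁ b₀ b₁ h
  obtain ⟨i, hi⟩ := exists_of_finset step {a₀, a₁, b₀, b₁}
  obtain ⟨a₀, rfl⟩ := hi a₀ (by simp)
  obtain ⟨a₁, rfl⟩ := hi a₁ (by simp)
  obtain ⟨b₀, rfl⟩ := hi b₀ (by simp)
  obtain ⟨b₁, rfl⟩ := hi b₁ (by simp)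
  rw [← map_add, ← map_add] at h
  obtain ⟨c₀₀, c₀₁, c₁₀, c₁₁, h₁, h₂, h₃, h₄⟩ :=
    (hp i).1 _ _ _ _ (of_injective step hs i h)
  refine ⟨of step (i + 1) c₀₀, of step (i + 1) c₀₁, of step (i + 1) c₁₀, of step (i + 1) c₁₁, ?_⟩
  simp only [← map_add, ← h₁, ← h₂, ← h₃, ← h₄, of_step, and_self]

theorem isNormallyDivisible (hp : ∀ n, SolvesProblems (step n)) :
    IsNormallyDivisible (SeqLimit step) := by
  classical
  intro p hp₀ X a
  obtain ⟨i, hi⟩ := exists_of_finset step (insert a X)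
  obtain ⟨a, rfl⟩ := hi a (by simp)
  obtain ⟨u, hu, hxy⟩ := (hp i).2 p hp₀ a
  refine ⟨of step (i + 1) u, by rw [← map_nsmul, hu, of_step], fun x hx y hy h ↦ ?_⟩
  obtain ⟨x, rfl⟩ := hi x (Finset.mem_insert_of_mem hx)
  obtain ⟨y, rfl⟩ := hi y (Finset.mem_insert_of_mem hy)
  rw [← map_add, ← map_add] at h
  rw [← of_step step i x, ← of_step step i y, ← map_add, ← map_add,
    hxy x y (of_injective step hs i h)]

end SeqLimit

end Limit

/-- A bundled conical commutative monoid. -/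
structure BundledCone where
  /-- The underlying type. -/
  carrier : Type u
  [inst : AddCommMonoid carrier]
  conical : IsConical carrier

attribute [instance] BundledCone.inst

/-- The universal extension of a cone, as a cone. -/
noncomputable def BundledCone.next (C : BundledCone.{u}) : BundledCone.{u} where
  carrier := (universalPartialHom C.conical).Ext
  conical := isConical_universalPartialHom_ext C.conical

/-- The iterated universal extensions of a cone. -/
noncomputable def BundledCone.tower (C : BundledCone.{u}) : ℕ → BundledCone.{u}
  | 0 => C
  | n + 1 => (C.tower n).next

/-- The canonical map from each iterated universal extension to the following one. -/
noncomputable def BundledCone.step (C : BundledCone.{u}) (n : ℕ) :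
    (C.tower n).carrier →+ (C.tower (n + 1)).carrier :=
  (universalPartialHom (C.tower n).conical).incl

/-- Every cone admits a unitary embedding into a normally divisible
refinement cone. -/
theorem cone_unitary_embeds_into_normallyDivisible_refinement_cone
    (M : Type u) [AddCommMonoid M] (hM : IsConical M) :
    ∃ (N : Type u) (_ : AddCommMonoid N),
      IsConical N ∧ IsNormallyDivisible N ∧ IsRefinementMonoid N ∧
      ∃ f : M →+ N, IsUnitary f := by
  let C : BundledCone.{u} := ⟨M, hM⟩
  have hs (n : ℕ) : IsUnitary (C.step n) := PartialHom.isUnitary_incl _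
  have hp (n : ℕ) : SolvesProblems (C.step n) := solvesProblems_universalPartialHom _
  exact ⟨SeqLimit C.step, inferInstance,
    SeqLimit.isConical C.step hs fun n ↦ (C.tower n).conical,
    SeqLimit.isNormallyDivisible C.step hs hp, SeqLimit.isRefinementMonoid C.step hs hp,
    SeqLimit.of C.step 0, SeqLimit.isUnitary_of C.step hs 0⟩
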